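/- arXiv:2308.08335 — 5 statements merged into one kernel-verified Lean document; each statement's English description precedes it below -/
import Mathlib

section
/- Let Q ∈ ℝ^{nw×nw} and R ∈ ℝ^{nz×nz} be symmetric, S ∈ ℝ^{nw×nz}, and let M ∈ ℝ^{n×n} be symmetric positive definite. Write A_v(x,w) = ∂f/∂x(x,w), B_v(x,w) = ∂f/∂w(x,w), C_v(x,w) = ∂h/∂x(x,w), D_v(x,w) = ∂h/∂w(x,w). Suppose that for all (x, w) the symmetric block matrix with blocks (1,1): A_v(x,w)ᵀM + M A_v(x,w) − C_v(x,w)ᵀ R C_v(x,w), (1,2): M B_v(x,w) − C_v(x,w)ᵀ Sᵀ − C_v(x,w)ᵀ R D_v(x,w), (2,2): −Q − S D_v(x,w) − D_v(x,w)ᵀ Sᵀ − D_v(x,w)ᵀ R D_v(x,w), is negative semidefinite. Then the system is (Q,S,R) velocity dissipative with quadratic storage S_v(v) = vᵀ M v: for all 0 ≤ t₀ ≤ t₁ and all differentiable solutions (x, w, z), ẋ(t₁)ᵀ M ẋ(t₁) − ẋ(t₀)ᵀ M ẋ(t₀) ≤ ∫_{t₀}^{t₁} ( ẇ(t)ᵀ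 Q ẇ(t) + 2 ẇ(t)ᵀ S ż(t) + ż(t)ᵀ R ż(t) ) dt. -/
open Matrix MeasureTheory

/-- The Jacobian `∂f/∂x` of `f : ℝⁿ × ℝ^nw → ℝⁿ` (in curried form) as a matrix. -/
noncomputable def jacMatX {n m k : ℕ} (f : (Fin n → ℝ) → (Fin m → ℝ) → (Fin k → ℝ))
    (x : Fin n → ℝ) (w : Fin m → ℝ) : Matrix (Fin k) (Fin n) ℝ :=
  LinearMap.toMatrix' (fderiv ℝ (fun a => f a w) x).toLinearMap

/-- The Jacobian `∂f/∂w` of `f : ℝⁿ × ℝ^nw → ℝ^k` (in curried form) as a matrix. -/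
noncomputable def jacMatW {n m k : ℕ} (f : (Fin n → ℝ) → (Fin m → ℝ) → (Fin k → ℝ))
    (x : Fin n → ℝ) (w : Fin m → ℝ) : Matrix (Fin k) (Fin m) ℝ :=
  LinearMap.toMatrix' (fderiv ℝ (fun b => f x b) w).toLinearMap

/-- Chain rule along a curve, in terms of the partial Jacobian matrices. -/
theorem hasDerivAt_comp_jacMat {n m k : ℕ} {f : (Fin n → ℝ) → (Fin m → ℝ) → (Fin k → ℝ)}
    {x : ℝ → Fin n → ℝ} {w : ℝ → Fin m → ℝ} {v : Fin n → ℝ} {u : Fin m → ℝ} {t : ℝ}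
    (hf : DifferentiableAt ℝ (Function.uncurry f) (x t, w t))
    (hx : HasDerivAt x v t) (hw : HasDerivAt w u t) :
    HasDerivAt (fun s => f (x s) (w s))
      (jacMatX f (x t) (w t) *ᵥ v + jacMatW f (x t) (w t) *ᵥ u) t := by
  have hL := hf.hasFDerivAt
  set L := fderiv ℝ (Function.uncurry f) (x t, w t)
  have h1 : HasFDerivAt (fun a => f a (w t)) (L.comp (.inl ℝ _ _)) (x t) :=
    HasFDerivAt.comp (f := fun a => (a, w t)) (x t) hL
      (hasFDerivAt_prodMk_left (x t) (w t))
  have h2 : HasFDerivAt (fun b => f (x t) b) (L.comp (.inr ℝ _ _)) (w t) :=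
    HasFDerivAt.comp (f := fun b => (x t, b)) (w t) hL
      (hasFDerivAt_prodMk_right (x t) (w t))
  have h3 : HasDerivAt (fun s => f (x s) (w s)) (L (v, u)) t :=
    HasFDerivAt.comp_hasDerivAt (f := fun s => (x s, w s)) t hL (hx.prodMk hw)
  convert h3 using 1
  simp only [jacMatX, jacMatW, h1.fderiv, h2.fderiv, LinearMap.toMatrix'_mulVec,
    ContinuousLinearMap.coe_coe, ContinuousLinearMap.comp_apply, ContinuousLinearMap.inl_apply,
    ContinuousLinearMap.inr_apply]
  rw [← map_add]
  simp

/-- Derivative of a quadratic form along a curve. -/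
theorem hasDerivAt_dotProduct_mulVec {n : ℕ} (M : Matrix (Fin n) (Fin n) ℝ)
    {g : ℝ → Fin n → ℝ} {g' : Fin n → ℝ} {t : ℝ} (hg : HasDerivAt g g' t) :
    HasDerivAt (fun s => g s ⬝ᵥ M *ᵥ g s) (g' ⬝ᵥ M *ᵥ g t + g t ⬝ᵥ M *ᵥ g') t := by
  have hMg : HasDerivAt (fun s => M *ᵥ g s) (M *ᵥ g') t :=
    (M.mulVecLin.toContinuousLinearMap.hasFDerivAt (x := g t)).comp_hasDerivAt t hg
  rw [hasDerivAt_pi] at hg hMg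
  simp only [dotProduct, ← Finset.sum_add_distrib]
  exact HasDerivAt.fun_sum fun i _ => (hg i).mul (hMg i)

/-- The dissipation inequality in differential form implied by the matrix inequality. -/
theorem storage_rate_le_supply_rate {n m k : ℕ}
    {A M : Matrix (Fin n) (Fin n) ℝ} {B : Matrix (Fin n) (Fin m) ℝ}
    {C : Matrix (Fin k) (Fin n) ℝ} {D : Matrix (Fin k) (Fin m) ℝ}
    {Q : Matrix (Fin m) (Fin m) ℝ} {R : Matrix (Fin k) (Fin k) ℝ} {S : Matrix (Fin m) (Fin k) ℝ}
    (hR : R.IsSymm) (hM : M.IsSymm)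
    (hLMI : (-(Matrix.fromBlocks
      (Aᵀ * M + M * A - Cᵀ * R * C) (M * B - Cᵀ * Sᵀ - Cᵀ * R * D)
      (M * B - Cᵀ * Sᵀ - Cᵀ * R * D)ᵀ (-Q - S * D - Dᵀ * Sᵀ - Dᵀ * R * D))).PosSemidef)
    (v : Fin n → ℝ) (u : Fin m → ℝ) :
    (A *ᵥ v + B *ᵥ u) ⬝ᵥ M *ᵥ v + v ⬝ᵥ M *ᵥ (A *ᵥ v + B *ᵥ u) ≤
      u ⬝ᵥ Q *ᵥ u + 2 * (u ⬝ᵥ S *ᵥ (C *ᵥ v + D *ᵥ u)) +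
        (C *ᵥ v + D *ᵥ u) ⬝ᵥ R *ᵥ (C *ᵥ v + D *ᵥ u) := by
  have hpsd := hLMI.dotProduct_mulVec_nonneg (Sum.elim v u)
  have htr {p q : ℕ} (N : Matrix (Fin p) (Fin q) ℝ) (a : Fin q → ℝ) (b : Fin p → ℝ) :
      a ⬝ᵥ Nᵀ *ᵥ b = N *ᵥ a ⬝ᵥ b := by
    rw [dotProduct_mulVec, vecMul_transpose]
  simp only [star_trivial, neg_mulVec, dotProduct_neg, fromBlocks_mulVec,
    Sum.elim_comp_inl, Sum.elim_comp_inr, sumElim_dotProduct_sumElim, transpose_sub, transpose_mul,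
    transpose_transpose, hR.eq, hM.eq, add_mulVec, sub_mulVec, dotProduct_add, dotProduct_sub,
    ← mulVec_mulVec, htr] at hpsd
  simp only [mulVec_add, add_dotProduct, dotProduct_add]
  linarith [dotProduct_comm (S *ᵥ C *ᵥ v) u, dotProduct_comm (S *ᵥ D *ᵥ u) u]

/-- **`(Q,S,R)` velocity dissipativity condition (matrix inequality).**
If the block matrix LMI built from the velocity-form matrices
`A_v = ∂f/∂x`, `B_v = ∂f/∂w`, `C_v = ∂h/∂x`, `D_v = ∂h/∂w` and the storage matrix `M ≻ 0`
is negative semidefinite for all `(x, w)`, then the system is `(Q,S,R)` velocity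
dissipative with quadratic storage `S_v(v) = vᵀ M v`. -/
theorem QSR_velocity_dissipativity_condition
    {n nw nz : ℕ}
    (f : (Fin n → ℝ) → (Fin nw → ℝ) → (Fin n → ℝ))
    (h : (Fin n → ℝ) → (Fin nw → ℝ) → (Fin nz → ℝ))
    (hf : ContDiff ℝ 1 (Function.uncurry f))
    (hh : ContDiff ℝ 1 (Function.uncurry h))
    (Q : Matrix (Fin nw) (Fin nw) ℝ) (hQ : Q.IsSymm)
    (R : Matrix (Fin nz) (Fin nz) ℝ) (hR : R.IsSymm)
    (S : Matrix (Fin nw) (Fin nz) ℝ)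
    (M : Matrix (Fin n) (Fin n) ℝ) (hM : M.PosDef)
    (hLMI : ∀ (x : Fin n → ℝ) (w : Fin nw → ℝ),
      -- negative semidefiniteness of the block matrix
      (-(Matrix.fromBlocks
        ((jacMatX f x w)ᵀ * M + M * jacMatX f x w - (jacMatX h x w)ᵀ * R * jacMatX h x w)
        (M * jacMatW f x w - (jacMatX h x w)ᵀ * Sᵀ - (jacMatX h x w)ᵀ * R * jacMatW h x w)
        (M * jacMatW f x w - (jacMatX h x w)ᵀ * Sᵀ - (jacMatX h x w)ᵀ * R * jacMatW h x w)ᵀ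
        (-Q - S * jacMatW h x w - (jacMatW h x w)ᵀ * Sᵀ -
          (jacMatW h x w)ᵀ * R * jacMatW h x w))).PosSemidef) :
    -- conclusion: `(Q,S,R)` velocity dissipativity with storage `S_v(v) = vᵀ M v`
    ∀ (x : ℝ → (Fin n → ℝ)) (w : ℝ → (Fin nw → ℝ)) (z : ℝ → (Fin nz → ℝ))
      (dw : ℝ → (Fin nw → ℝ)) (dz : ℝ → (Fin nz → ℝ)),
      (∀ t : ℝ, 0 ≤ t → HasDerivAt x (f (x t) (w t)) t) →
      (∀ t : ℝ, 0 ≤ t → z t = h (x t) (w t)) →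
      (∀ t : ℝ, 0 ≤ t → HasDerivAt w (dw t) t) →
      (∀ t : ℝ, 0 ≤ t → HasDerivAt z (dz t) t) →
      ContinuousOn dw (Set.Ici 0) → ContinuousOn dz (Set.Ici 0) →
      ∀ t₀ t₁ : ℝ, 0 ≤ t₀ → t₀ ≤ t₁ →
        f (x t₁) (w t₁) ⬝ᵥ M.mulVec (f (x t₁) (w t₁)) -
          f (x t₀) (w t₀) ⬝ᵥ M.mulVec (f (x t₀) (w t₀)) ≤
        ∫ t in t₀..t₁,
          (dw t ⬝ᵥ Q.mulVec (dw t) + 2 * (dw t ⬝ᵥ S.mulVec (dz t)) +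
            dz t ⬝ᵥ R.mulVec (dz t)) := by
  intro x w z dw dz hx hz hw hdz cdw cdz t₀ t₁ ht₀ h01
  have hMs : M.IsSymm := by simpa [Matrix.IsSymm] using hM.isHermitian.eq
  have hV : ∀ t, 0 ≤ t → HasDerivAt (fun s => f (x s) (w s) ⬝ᵥ M *ᵥ f (x s) (w s)) _ t :=
    fun t h0 => hasDerivAt_dotProduct_mulVec M
      (hasDerivAt_comp_jacMat (hf.differentiable one_ne_zero _) (hx t h0) (hw t h0))
  have hsub : Set.Icc t₀ t₁ ⊆ Set.Ici 0 := fun t ht => ht₀.trans ht.1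
  have cw := cdw.mono hsub
  have cz := cdz.mono hsub
  have hcont : ContinuousOn (fun t => dw t ⬝ᵥ Q *ᵥ dw t + 2 * (dw t ⬝ᵥ S *ᵥ dz t) +
      dz t ⬝ᵥ R *ᵥ dz t) (Set.Icc t₀ t₁) := by
    rw [continuousOn_iff_continuous_domRestrict] at cw cz ⊢
    exact ((cw.dotProduct (continuous_const.matrix_mulVec cw)).add
      (continuous_const.mul (cw.dotProduct (continuous_const.matrix_mulVec cz)))).add
      (cz.dotProduct (continuous_const.matrix_mulVec cz))
  refine intervalIntegral.sub_le_integral_of_hasDeriv_right_of_le h01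
    (fun t ht => (hV t (hsub ht)).continuousAt.continuousWithinAt)
    (fun t ht => (hV t (hsub (Set.Ioo_subset_Icc_self ht))).hasDerivWithinAt)
    hcont.integrableOn_Icc fun t ht => ?_
  have h0 : 0 < t := ht₀.trans_lt ht.1
  have hdz_eq : dz t = jacMatX h (x t) (w t) *ᵥ f (x t) (w t) + jacMatW h (x t) (w t) *ᵥ dw t := by
    refine (hdz t h0.le).unique ((hasDerivAt_comp_jacMat (hh.differentiable one_ne_zero _)
      (hx t h0.le) (hw t h0.le)).congr_of_eventuallyEq ?_)
    filter_upwards [Ioi_mem_nhds h0] with s hs using hz s (le_of_lt hs)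
  rw [hdz_eq]
  exact storage_rate_le_supply_rate hR hMs (hLMI _ _) _ _
end

section
/- Assume that for every equilibrium pair (x*, w*), x* is the unique point with f(x*, w*) = 0 (uniqueness of equilibria). Suppose there exists a continuously differentiable function V_v : ℝⁿ → [0, ∞) with V_v(0) = 0 and V_v(v) > 0 for all v ≠ 0, such that for every equilibrium input value w* and every solution x of ẋ(t) = f(x(t), w*) (with x twice continuously differentiable), (d/dt) V_v(ẋ(t)) ≤ 0 for all t ≥ 0. Then the system is universally shifted stable: for every equilibrium pair (x*, w*) and every ε > 0 there exists δ > 0 such that every twice continuously differentiable solution with constant input w ≡ w* and ‖x(0) − x*‖ < δ satisfies ‖x(t) − x*‖ < ε for all t ≥ 0. -/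
/-- A trajectory along which a continuous function `W` is non-increasing cannot cross a sphere on
which `W` is larger than its initial value. -/
theorem norm_sub_lt_of_antitoneOn_of_lt_on_sphere {E : Type*} [NormedAddCommGroup E]
    {W : E → ℝ} {x : ℝ → E} {c : E} {r : ℝ} (hx : ContinuousOn x (Set.Ici 0))
    (hW : AntitoneOn (fun t => W (x t)) (Set.Ici 0)) (h0 : ‖x 0 - c‖ < r)
    (hr : ∀ y ∈ Metric.sphere c r, W (x 0) < W y) {t : ℝ} (ht : 0 ≤ t) :
    ‖x t - c‖ < r := by
  by_contra! hge
  have hcont : ContinuousOn (fun s => ‖x s - c‖) (Set.Icc 0 t) :=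
    ((hx.mono Set.Icc_subset_Ici_self).sub continuousOn_const).norm
  obtain ⟨s, hs, hsr⟩ := intermediate_value_Icc ht hcont ⟨h0.le, hge⟩
  exact (hW Set.self_mem_Ici hs.1 hs.1).not_gt (hr _ (mem_sphere_iff_norm.2 hsr))

/-- Lyapunov's stability argument: a continuous function that is positive away from its zero `c`
makes `c` stable for every family of continuous trajectories along which it is non-increasing. -/
theorem exists_delta_of_antitoneOn {E : Type*} [NormedAddCommGroup E] [ProperSpace E]
    {W : E → ℝ} {c : E} (hW : Continuous W) (hc : W c = 0) (hpos : ∀ y, y ≠ c → 0 < W y)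
    {ε : ℝ} (hε : 0 < ε) :
    ∃ δ > (0 : ℝ), ∀ x : ℝ → E, ContinuousOn x (Set.Ici 0) →
      AntitoneOn (fun t => W (x t)) (Set.Ici 0) → ‖x 0 - c‖ < δ →
      ∀ t : ℝ, 0 ≤ t → ‖x t - c‖ < ε := by
  obtain ⟨m, hm, hmS⟩ : ∃ m > (0 : ℝ), ∀ y ∈ Metric.sphere c ε, m ≤ W y := by
    rcases (Metric.sphere c ε).eq_empty_or_nonempty with hS | hS
    · exact ⟨1, one_pos, by simp [hS]⟩
    · obtain ⟨y, hy, hmin⟩ := (isCompact_sphere c ε).exists_isMinOn hS hW.continuousOn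
      exact ⟨W y, hpos y (Metric.ne_of_mem_sphere hy hε.ne'), fun z hz => hmin hz⟩
  obtain ⟨δ, hδ, hball⟩ := Metric.eventually_nhds_iff.1
    (hW.continuousAt.eventually_lt_const (hc.trans_lt hm))
  refine ⟨min δ ε, lt_min hδ hε, fun x hx hanti h0 t ht => ?_⟩
  have hW0 : W (x 0) < m := hball (by rw [dist_eq_norm]; exact h0.trans_le (min_le_left _ _))
  exact norm_sub_lt_of_antitoneOn_of_lt_on_sphere hx hanti (h0.trans_le (min_le_right _ _))
    (fun y hy => hW0.trans_le (hmS y hy)) ht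

/-- **Implied universal shifted stability (velocity Lyapunov function).**
Assume equilibria are unique per input value. If there is a `C¹` function
`V_v : ℝⁿ → [0,∞)` with `V_v 0 = 0`, `V_v v > 0` for `v ≠ 0`, which is non-increasing
along the state velocity `ẋ(t) = f(x(t), w*)` of every (twice continuously
differentiable) solution with constant input `w ≡ w*`, then the system is
universally shifted stable. -/
theorem implied_universal_shifted_stability_velocity
    {n nw nz : ℕ}
    (f : EuclideanSpace ℝ (Fin n) → EuclideanSpace ℝ (Fin nw) → EuclideanSpace ℝ (Fin n))
    (h : EuclideanSpace ℝ (Fin n) → EuclideanSpace ℝ (Fin nw) → EuclideanSpace ℝ (Fin nz))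
    (hf : ContDiff ℝ 1 (Function.uncurry f))
    (hh : ContDiff ℝ 1 (Function.uncurry h))
    (huniq : ∀ (ws : EuclideanSpace ℝ (Fin nw)) (xs xs' : EuclideanSpace ℝ (Fin n)),
      f xs ws = 0 → f xs' ws = 0 → xs = xs')
    (Vv : EuclideanSpace ℝ (Fin n) → ℝ)
    (hVv : ContDiff ℝ 1 Vv) (hVvNonneg : ∀ v, 0 ≤ Vv v) (hVv0 : Vv 0 = 0)
    (hVvPos : ∀ v, v ≠ 0 → 0 < Vv v)
    (hdecr : ∀ ws : EuclideanSpace ℝ (Fin nw),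
      (∃ xs, f xs ws = 0) →
      ∀ x : ℝ → EuclideanSpace ℝ (Fin n),
        (∀ t : ℝ, 0 ≤ t → HasDerivAt x (f (x t) ws) t) →
        ContDiffOn ℝ 2 x (Set.Ici 0) →
        ∀ t : ℝ, 0 ≤ t → deriv (fun τ => Vv (f (x τ) ws)) t ≤ 0) :
    ∀ (xs : EuclideanSpace ℝ (Fin n)) (ws : EuclideanSpace ℝ (Fin nw)),
      f xs ws = 0 →
      ∀ ε > (0:ℝ), ∃ δ > (0:ℝ),
        ∀ (x : ℝ → EuclideanSpace ℝ (Fin n)) (z : ℝ → EuclideanSpace ℝ (Fin nz)),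
          (∀ t : ℝ, 0 ≤ t → HasDerivAt x (f (x t) ws) t) →
          ContDiffOn ℝ 2 x (Set.Ici 0) →
          (∀ t : ℝ, 0 ≤ t → z t = h (x t) ws) →
          ‖x 0 - xs‖ < δ →
          ∀ t : ℝ, 0 ≤ t → ‖x t - xs‖ < ε := by
  intro xs ws hxs ε hε
  have hW : ContDiff ℝ 1 (fun y => Vv (f y ws)) :=
    hVv.comp (hf.comp (contDiff_id.prodMk contDiff_const))
  obtain ⟨δ, hδ, hstable⟩ := exists_delta_of_antitoneOn hW.continuous (c := xs)
    (by simp only [hxs, hVv0]) (fun y hy => hVvPos _ fun h0 => hy (huniq ws y xs h0 hxs)) hε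
  refine ⟨δ, hδ, fun x _ hx hx2 _ h0 => hstable x hx2.continuousOn ?_ h0⟩
  have hdiff : ∀ t : ℝ, 0 ≤ t → DifferentiableAt ℝ (fun τ => Vv (f (x τ) ws)) t := fun t ht =>
    (hW.differentiable one_ne_zero (x t)).comp t (hx t ht).differentiableAt
  refine antitoneOn_of_deriv_nonpos (convex_Ici 0)
    (fun t ht => (hdiff t ht).continuousAt.continuousWithinAt)
    (fun t ht => (hdiff t (interior_subset ht)).differentiableWithinAt)
    (fun t ht => hdecr ws ⟨xs, hxs⟩ x hx hx2 t (interior_subset ht))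
end

section
/- Assume that for every equilibrium pair (x*, w*), x* is the unique point with f(x*, w*) = 0 (uniqueness of equilibria). Suppose there exists a continuously differentiable function V_v : ℝⁿ → [0, ∞) with V_v(0) = 0 and V_v(v) > 0 for all v ≠ 0, such that for every equilibrium input value w* and every solution x of ẋ(t) = f(x(t), w*) (with x twice continuously differentiable), (d/dt) V_v(ẋ(t)) < 0 for all t ≥ 0 with ẋ(t) ≠ 0. Then the system is universally shifted asymptotically stable: for every equilibrium pair (x*, w*) and every ε > 0 there exists δ > 0 such that every twice continuously differentiable solution with constant input w ≡ w* and ‖x(0) − x*‖ < δ satisfies ‖x(t) − x*‖ < ε for all t ≥ 0 and x(t) → x* as t → ∞. -/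
open Set Filter Topology NNReal

/-- A bounded, globally Lipschitz vector field has a global integral curve through each point. -/
theorem exists_forall_hasDerivAt_of_lipschitzWith {E : Type*} [NormedAddCommGroup E]
    [NormedSpace ℝ E] [CompleteSpace E] {g : E → E} {K L : ℝ≥0} (hg : LipschitzWith K g)
    (hL : ∀ x, ‖g x‖ ≤ L) (y : E) :
    ∃ φ : ℝ → E, φ 0 = y ∧ ∀ t, HasDerivAt φ (g (φ t)) t := by
  have hloc : ∀ a : ℝ, ∃ γ : ℝ → E, 0 < a →
      γ 0 = y ∧ ∀ t ∈ Ioo (-a) a, HasDerivAt γ (g (γ t)) t := by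
    intro a
    rcases le_or_gt a 0 with ha | ha
    · exact ⟨fun _ => y, fun h => absurd h ha.not_gt⟩
    have hpl : IsPicardLindelof (fun _ => g) (tmin := -a) (tmax := a)
        ⟨0, by constructor <;> linarith⟩ y (L * a.toNNReal) 0 L K :=
      { lipschitzOnWith := fun _ _ => hg.lipschitzOnWith
        continuousOn := fun _ _ => continuousOn_const
        norm_le := fun _ _ x _ => hL x
        mul_max_le := by simp [ha.le] }
    obtain ⟨γ, h0, hγ⟩ := hpl.exists_eq_forall_mem_Icc_hasDerivWithinAt₀
    exact ⟨γ, fun _ => ⟨h0, fun t ht =>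
      (hγ t (Ioo_subset_Icc_self ht)).hasDerivAt (Icc_mem_nhds ht.1 ht.2)⟩⟩
  choose γ hγ using hloc
  have hagree : ∀ {a b : ℝ}, 0 < a → a ≤ b → EqOn (γ a) (γ b) (Ioo (-a) a) := by
    intro a b ha hab
    have hb := ha.trans_le hab
    refine ODE_solution_unique_of_mem_Ioo (v := fun _ => g) (s := fun _ => univ) (K := K)
      (t₀ := 0) (fun _ _ => hg.lipschitzOnWith) ⟨by linarith, ha⟩
      (fun t ht => ⟨(hγ a ha).2 t ht, mem_univ _⟩)
      (fun t ht => ⟨(hγ b hb).2 t ⟨by linarith [ht.1], by linarith [ht.2]⟩, mem_univ _⟩) ?_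
    rw [(hγ a ha).1, (hγ b hb).1]
  have hmem : ∀ s : ℝ, s ∈ Ioo (-(|s| + 1)) (|s| + 1) :=
    fun s => abs_lt.mp (lt_add_one |s|)
  refine ⟨fun t => γ (|t| + 1) t, (hγ _ (by positivity)).1, fun t => ?_⟩
  have hpos : ∀ s : ℝ, 0 < |s| + 1 := fun s => by positivity
  have hev : (fun s => γ (|s| + 1) s) =ᶠ[𝓝 t] γ (|t| + 2) := by
    have : ∀ᶠ s in 𝓝 t, |s| < |t| + 1 :=
      continuous_abs.continuousAt.eventually (gt_mem_nhds (lt_add_one |t|))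
    filter_upwards [this] with s hs
    exact hagree (hpos s) (by linarith) (hmem s)
  refine HasDerivAt.congr_of_eventuallyEq ?_ hev
  dsimp only
  rw [hev.eq_of_nhds]
  exact (hγ _ (by positivity)).2 t (abs_lt.mp (by linarith))

/-- A `C¹` map agrees on any bounded set with a compactly supported `C¹` map. -/
theorem ContDiff.exists_hasCompactSupport_eqOn {E F : Type*} [NormedAddCommGroup E]
    [NormedSpace ℝ E] [FiniteDimensional ℝ E] [NormedAddCommGroup F] [NormedSpace ℝ F]
    {f : E → F} (hf : ContDiff ℝ 1 f) {s : Set E} (hs : Bornology.IsBounded s) :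
    ∃ g : E → F, ContDiff ℝ 1 g ∧ HasCompactSupport g ∧ EqOn g f s := by
  obtain ⟨R, hR, hsR⟩ := hs.subset_closedBall_lt 0 0
  let χ : ContDiffBump (0 : E) := ⟨R, R + 1, hR, by linarith⟩
  exact ⟨fun x => χ x • f x, χ.contDiff.smul hf, χ.hasCompactSupport.smul_right,
    fun x hx => by simp [χ.one_of_mem_closedBall (hsR hx)]⟩

/-- Positive invariance of `ω`-limit sets: through any cluster point of a bounded solution there
passes a `C²` forward solution consisting of cluster points of the original one. -/
theorem exists_solution_mapClusterPt {E : Type*} [NormedAddCommGroup E] [NormedSpace ℝ E]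
    [FiniteDimensional ℝ E] {f : E → E} (hf : ContDiff ℝ 1 f) {s : Set E}
    (hs : IsCompact s) {x : ℝ → E} (hx : ∀ t, 0 ≤ t → HasDerivAt x (f (x t)) t)
    (hxs : ∀ t, 0 ≤ t → x t ∈ s) {y : E} (hy : MapClusterPt y atTop x) :
    ∃ φ : ℝ → E, φ 0 = y ∧ ContDiff ℝ 2 φ ∧ (∀ t, 0 ≤ t → HasDerivAt φ (f (φ t)) t) ∧
      ∀ t, 0 ≤ t → MapClusterPt (φ t) atTop x := by
  have : CompleteSpace E := FiniteDimensional.complete ℝ E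
  obtain ⟨g, hg, hgc, hgf⟩ := hf.exists_hasCompactSupport_eqOn hs.isBounded
  obtain ⟨K, hK⟩ := hg.lipschitzWith_of_hasCompactSupport hgc one_ne_zero
  obtain ⟨C, hC⟩ := hgc.exists_bound_of_continuous hg.continuous
  obtain ⟨φ, hφ0, hφ⟩ := exists_forall_hasDerivAt_of_lipschitzWith hK (L := C.toNNReal)
    (fun x => (hC x).trans (Real.le_coe_toNNReal C)) y
  obtain ⟨U, hU, hUy⟩ := mapClusterPt_iff_ultrafilter.mp hy
  have hlim : ∀ t, 0 ≤ t → Tendsto (fun τ => x (τ + t)) U (𝓝 (φ t)) := by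
    intro t ht
    rw [tendsto_iff_dist_tendsto_zero] at hUy ⊢
    have hb : Tendsto (fun τ => dist (x τ) y * Real.exp (K * (t - 0))) U (𝓝 0) := by
      simpa using hUy.mul_const (Real.exp (K * (t - 0)))
    refine squeeze_zero' (Eventually.of_forall fun _ => dist_nonneg) ?_ hb
    filter_upwards [hU (eventually_ge_atTop (0 : ℝ))] with τ hτ
    have hder : ∀ r, 0 ≤ r → HasDerivAt (fun r => x (τ + r)) (g (x (τ + r))) r := by
      intro r hr
      rw [hgf (hxs _ (add_nonneg hτ hr))]
      exact (hx _ (add_nonneg hτ hr)).comp_const_add τ r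
    refine dist_le_of_trajectories_ODE (v := fun _ => g) (f := fun r => x (τ + r)) (g := φ)
      (fun _ => hK) (fun r hr => (hder r hr.1).continuousAt.continuousWithinAt)
      (fun r hr => (hder r hr.1).hasDerivWithinAt)
      (fun r _ => (hφ r).continuousAt.continuousWithinAt)
      (fun r _ => (hφ r).hasDerivWithinAt) ?_ t ⟨ht, le_rfl⟩
    simp [hφ0]
  have hclus : ∀ t, 0 ≤ t → MapClusterPt (φ t) atTop x := fun t ht =>
    (hlim t ht).mapClusterPt.of_comp ((tendsto_atTop_add_const_right _ t tendsto_id).mono_left hU)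
  have hφs : ∀ t, 0 ≤ t → φ t ∈ s := fun t ht =>
    hs.isClosed.mem_of_tendsto (hlim t ht) <| by
      filter_upwards [hU (eventually_ge_atTop (0 : ℝ))] with τ hτ
      exact hxs _ (add_nonneg hτ ht)
  have hderiv : deriv φ = g ∘ φ := funext fun t => (hφ t).deriv
  have hdiff : Differentiable ℝ φ := fun t => (hφ t).differentiableAt
  have hφ1 : ContDiff ℝ 1 φ := by
    rw [contDiff_one_iff_deriv, hderiv]
    exact ⟨hdiff, hg.continuous.comp hdiff.continuous⟩
  refine ⟨φ, hφ0, ?_, fun t ht => ?_, hclus⟩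
  · rw [show (2 : WithTop ℕ∞) = 1 + 1 by norm_num, contDiff_succ_iff_deriv, hderiv]
    exact ⟨hdiff, by simp, hg.comp hφ1⟩
  · rw [← hgf (hφs t ht)]
    exact hφ t

/-- A solution starting close to a strict minimum `p` of `W` on a closed ball, along which `W`
is nonincreasing, stays in that ball. -/
theorem exists_forall_norm_sub_lt_of_antitoneOn {E : Type*} [NormedAddCommGroup E]
    [NormedSpace ℝ E] [FiniteDimensional ℝ E] {W : E → ℝ} (hW : Continuous W) {p : E}
    (hp : W p = 0) (hpos : ∀ y, y ≠ p → 0 < W y) {ε : ℝ} (hε : 0 < ε) :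
    ∃ δ > (0 : ℝ), ∀ x : ℝ → E, ContinuousOn x (Ici 0) → AntitoneOn (W ∘ x) (Ici 0) →
      ‖x 0 - p‖ < δ → ∀ t, 0 ≤ t → ‖x t - p‖ < ε := by
  have hmin : ∃ m > (0 : ℝ), ∀ y ∈ Metric.sphere p ε, m ≤ W y := by
    rcases (Metric.sphere p ε).eq_empty_or_nonempty with he | hne
    · exact ⟨1, one_pos, by simp [he]⟩
    · obtain ⟨q, hq, hqm⟩ := (isCompact_sphere p ε).exists_isMinOn hne hW.continuousOn
      exact ⟨W q, hpos q (Metric.ne_of_mem_sphere hq hε.ne'), fun y hy => hqm hy⟩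
  obtain ⟨m, hm, hmW⟩ := hmin
  obtain ⟨δ, hδ, hδW⟩ := Metric.eventually_nhds_iff.mp
    (hW.continuousAt.eventually (gt_mem_nhds (hp.trans_lt hm)))
  refine ⟨min δ ε, lt_min hδ hε, fun x hx hanti h0 t ht => ?_⟩
  by_contra! hge
  have hcont : ContinuousOn (fun τ => ‖x τ - p‖) (Icc 0 t) :=
    ((hx.mono Icc_subset_Ici_self).sub continuousOn_const).norm
  obtain ⟨τ, hτ, hτε⟩ := intermediate_value_Icc ht hcont
    ⟨(h0.trans_le (min_le_right _ _)).le, hge⟩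
  have h1 : m ≤ W (x τ) := hmW _ (mem_sphere_iff_norm.mpr hτε)
  have h2 : W (x τ) ≤ W (x 0) := hanti self_mem_Ici hτ.1 hτ.1
  have h3 : W (x 0) < m := hδW (by rw [dist_eq_norm]; exact h0.trans_le (min_le_left _ _))
  linarith

/-- **Implied universal shifted asymptotic stability (velocity Lyapunov function).**
Assume equilibria are unique per input value. If there is a `C¹` function
`V_v : ℝⁿ → [0,∞)` with `V_v 0 = 0`, `V_v v > 0` for `v ≠ 0`, which is strictly
decreasing (whenever `ẋ(t) ≠ 0`) along the state velocity of every twice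
continuously differentiable solution with constant input `w ≡ w*`, then the
system is universally shifted asymptotically stable. -/
theorem implied_universal_shifted_asymptotic_stability_velocity
    {n nw nz : ℕ}
    (f : EuclideanSpace ℝ (Fin n) → EuclideanSpace ℝ (Fin nw) → EuclideanSpace ℝ (Fin n))
    (h : EuclideanSpace ℝ (Fin n) → EuclideanSpace ℝ (Fin nw) → EuclideanSpace ℝ (Fin nz))
    (hf : ContDiff ℝ 1 (Function.uncurry f))
    (hh : ContDiff ℝ 1 (Function.uncurry h))
    (huniq : ∀ (ws : EuclideanSpace ℝ (Fin nw)) (xs xs' : EuclideanSpace ℝ (Fin n)),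
      f xs ws = 0 → f xs' ws = 0 → xs = xs')
    (Vv : EuclideanSpace ℝ (Fin n) → ℝ)
    (hVv : ContDiff ℝ 1 Vv) (hVvNonneg : ∀ v, 0 ≤ Vv v) (hVv0 : Vv 0 = 0)
    (hVvPos : ∀ v, v ≠ 0 → 0 < Vv v)
    (hdecr : ∀ ws : EuclideanSpace ℝ (Fin nw),
      (∃ xs, f xs ws = 0) →
      ∀ x : ℝ → EuclideanSpace ℝ (Fin n),
        (∀ t : ℝ, 0 ≤ t → HasDerivAt x (f (x t) ws) t) →
        ContDiffOn ℝ 2 x (Set.Ici 0) →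
        ∀ t : ℝ, 0 ≤ t → f (x t) ws ≠ 0 →
          deriv (fun τ => Vv (f (x τ) ws)) t < 0) :
    ∀ (xs : EuclideanSpace ℝ (Fin n)) (ws : EuclideanSpace ℝ (Fin nw)),
      f xs ws = 0 →
      ∀ ε > (0:ℝ), ∃ δ > (0:ℝ),
        ∀ (x : ℝ → EuclideanSpace ℝ (Fin n)) (z : ℝ → EuclideanSpace ℝ (Fin nz)),
          (∀ t : ℝ, 0 ≤ t → HasDerivAt x (f (x t) ws) t) →
          ContDiffOn ℝ 2 x (Set.Ici 0) →
          (∀ t : ℝ, 0 ≤ t → z t = h (x t) ws) →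
          ‖x 0 - xs‖ < δ →
          (∀ t : ℝ, 0 ≤ t → ‖x t - xs‖ < ε) ∧
          Filter.Tendsto x Filter.atTop (nhds xs) := by
  intro xs ws hxs ε hε
  have hF : ContDiff ℝ 1 fun y => f y ws := hf.comp (contDiff_id.prodMk contDiff_const)
  have hW : ContDiff ℝ 1 fun y => Vv (f y ws) := hVv.comp hF
  have hWpos : ∀ y, y ≠ xs → 0 < Vv (f y ws) := fun y hy =>
    hVvPos _ fun h0 => hy (huniq ws y xs h0 hxs)
  obtain ⟨δ, hδ, hstab⟩ := exists_forall_norm_sub_lt_of_antitoneOn hW.continuous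
    (p := xs) (by rw [hxs, hVv0]) hWpos hε
  refine ⟨δ, hδ, fun x _ hx hx2 _ hx0 => ?_⟩
  have hcont : ContinuousOn x (Ici 0) := fun t ht => (hx t ht).continuousAt.continuousWithinAt
  have hWx : ∀ t, 0 ≤ t → DifferentiableAt ℝ (fun τ => Vv (f (x τ) ws)) t := fun t ht =>
    (hW.differentiable one_ne_zero (x t)).comp t (hx t ht).differentiableAt
  have hanti : AntitoneOn (fun τ => Vv (f (x τ) ws)) (Ici 0) := by
    refine antitoneOn_of_deriv_nonpos (convex_Ici 0)
      (fun t ht => (hWx t ht).continuousAt.continuousWithinAt)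
      (fun t ht => (hWx t (interior_subset ht)).differentiableWithinAt) fun t ht => ?_
    by_cases h0 : f (x t) ws = 0
    · refine le_of_eq (IsLocalMin.deriv_eq_zero (Eventually.of_forall fun τ => ?_))
      simpa only [h0, hVv0] using hVvNonneg _
    · exact (hdecr ws ⟨xs, hxs⟩ x hx hx2 t (interior_subset ht) h0).le
  have hball := hstab x hcont hanti hx0
  refine ⟨hball, ?_⟩
  have hmem : ∀ t, 0 ≤ t → x t ∈ Metric.closedBall xs ε := fun t ht =>
    mem_closedBall_iff_norm.mpr (hball t ht).le
  obtain ⟨c, hc⟩ : ∃ c, Tendsto (fun τ => Vv (f (x τ) ws)) atTop (𝓝 c) := by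
    have hA : Antitone fun τ => Vv (f (x (max 0 τ)) ws) := fun a b hab =>
      hanti (mem_Ici.mpr (le_max_left _ _)) (mem_Ici.mpr (le_max_left _ _)) (max_le_max_left 0 hab)
    refine ⟨_, (tendsto_atTop_ciInf hA ⟨0, ?_⟩).congr' ?_⟩
    · rintro _ ⟨τ, rfl⟩
      exact hVvNonneg _
    · filter_upwards [eventually_ge_atTop (0 : ℝ)] with τ hτ
      rw [max_eq_right hτ]
  have hlevel : ∀ y, MapClusterPt y atTop x → Vv (f y ws) = c := fun y hy => by
    obtain ⟨U, hU, hUy⟩ := mapClusterPt_iff_ultrafilter.mp hy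
    exact tendsto_nhds_unique ((hW.continuous.tendsto y).comp hUy) (hc.mono_left hU)
  refine (isCompact_closedBall xs ε).tendsto_nhds_of_unique_mapClusterPt
    ((eventually_ge_atTop 0).mono hmem) fun y _ hy => ?_
  by_contra hne
  obtain ⟨φ, -, hφ2, hφ, hφclus⟩ :=
    exists_solution_mapClusterPt hF (isCompact_closedBall xs ε) hx hmem hy
  have hconst : (fun τ => Vv (f (φ τ) ws)) =ᶠ[𝓝 1] fun _ => c := by
    filter_upwards [lt_mem_nhds (zero_lt_one (α := ℝ))] with τ hτ
    exact hlevel _ (hφclus τ hτ.le)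
  have hneg := hdecr ws ⟨xs, hxs⟩ φ hφ hφ2.contDiffOn 1 zero_le_one fun h0 => by
    have h1 := hconst.eq_of_nhds
    simp only [h0, hVv0] at h1
    exact (hWpos y hne).ne' ((hlevel y hy).trans h1.symm)
  rw [hconst.deriv_eq, deriv_const] at hneg
  exact hneg.false
end

section
/- Assume that for every equilibrium pair (x*, w*), x* is the unique point with f(x*, w*) = 0 (uniqueness of equilibria). Suppose the system is velocity dissipative with respect to a supply function s_v : ℝ^{nw} × ℝ^{nz} → ℝ: there exists a continuously differentiable storage function S_v : ℝⁿ → [0, ∞) with S_v(0) = 0 and S_v(v) > 0 for v ≠ 0, such that S_v(ẋ(t₁)) − S_v(ẋ(t₀)) ≤ ∫_{t₀}^{t₁} s_v(ẇ(t), ż(t)) dt for all 0 ≤ t₀ ≤ t₁ and all differentiable solutions (x, w, z). If s_v(0, ζ) ≤ 0 for all ζ ∈ ℝ^{nz}, then the system is universally shifted stable: for every equilibrium pair (x*, w*) and every ε > 0 there exists δ > 0 such that every differentiable solution with constant input w ≡ w* and ‖x(0) − x*‖ < δ satisfies ‖x(t) − x*‖ < ε for all t ≥ 0. -/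
open MeasureTheory

/-- Lyapunov stability: a continuous function that is positive away from `xs`, vanishes at `xs`
and is bounded along each trajectory by its initial value certifies stability of `xs`. -/
theorem exists_delta_of_lyapunov {E : Type*} [NormedAddCommGroup E] [ProperSpace E]
    {V : E → ℝ} (hV : Continuous V) {xs : E} (hV0 : V xs = 0) (hVpos : ∀ y, y ≠ xs → 0 < V y)
    {ε : ℝ} (hε : 0 < ε) :
    ∃ δ > (0 : ℝ), ∀ x : ℝ → E, ContinuousOn x (Set.Ici 0) →
      (∀ t, 0 ≤ t → V (x t) ≤ V (x 0)) → ‖x 0 - xs‖ < δ → ∀ t, 0 ≤ t → ‖x t - xs‖ < ε := by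
  obtain ⟨m, hm, hmV⟩ := (isCompact_sphere xs ε).exists_forall_le' (a := 0) hV.continuousOn
    fun y hy => hVpos y (Metric.ne_of_mem_sphere hy hε.ne')
  obtain ⟨δ, hδ, hδV⟩ := Metric.eventually_nhds_iff.1
    (hV.continuousAt.eventually_lt continuousAt_const (hV0.trans_lt hm))
  refine ⟨min δ ε, lt_min hδ hε, fun x hx hdecr hx0 t ht => ?_⟩
  by_contra! hxt
  have hcont : ContinuousOn (fun s => ‖x s - xs‖) (Set.Icc 0 t) :=
    ((hx.mono Set.Icc_subset_Ici_self).sub continuousOn_const).norm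
  obtain ⟨s, hs, hxs⟩ := intermediate_value_Icc ht hcont
    ⟨(hx0.trans_le (min_le_right _ _)).le, hxt⟩
  have hle : m ≤ V (x s) := hmV _ (mem_sphere_iff_norm.2 hxs)
  have hlt : V (x 0) < m := hδV (by
    rw [dist_eq_norm]
    exact hx0.trans_le (min_le_left _ _))
  exact (hle.trans (hdecr s hs.1)).not_gt hlt

/-- **Universal shifted stability from velocity dissipativity.**
Assume equilibria are unique per input value. If the system `ẋ = f(x,w)`,
`z = h(x,w)` is velocity dissipative w.r.t. a supply `s_v` (with a `C¹`
positive-definite storage `S_v`), and `s_v(0, ζ) ≤ 0` for all `ζ`, then the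
system is universally shifted stable. -/
theorem universal_shifted_stability_from_velocity_dissipativity
    {n nw nz : ℕ}
    (f : EuclideanSpace ℝ (Fin n) → EuclideanSpace ℝ (Fin nw) → EuclideanSpace ℝ (Fin n))
    (h : EuclideanSpace ℝ (Fin n) → EuclideanSpace ℝ (Fin nw) → EuclideanSpace ℝ (Fin nz))
    (hf : ContDiff ℝ 1 (Function.uncurry f))
    (hh : ContDiff ℝ 1 (Function.uncurry h))
    (huniq : ∀ (ws : EuclideanSpace ℝ (Fin nw)) (xs xs' : EuclideanSpace ℝ (Fin n)),
      f xs ws = 0 → f xs' ws = 0 → xs = xs')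
    (sv : EuclideanSpace ℝ (Fin nw) → EuclideanSpace ℝ (Fin nz) → ℝ)
    (Sv : EuclideanSpace ℝ (Fin n) → ℝ)
    (hSv : ContDiff ℝ 1 Sv) (hSvNonneg : ∀ v, 0 ≤ Sv v) (hSv0 : Sv 0 = 0)
    (hSvPos : ∀ v, v ≠ 0 → 0 < Sv v)
    (hVD : ∀ (x : ℝ → EuclideanSpace ℝ (Fin n)) (w : ℝ → EuclideanSpace ℝ (Fin nw))
        (z : ℝ → EuclideanSpace ℝ (Fin nz))
        (dw : ℝ → EuclideanSpace ℝ (Fin nw)) (dz : ℝ → EuclideanSpace ℝ (Fin nz)),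
      (∀ t : ℝ, 0 ≤ t → HasDerivAt x (f (x t) (w t)) t) →
      (∀ t : ℝ, 0 ≤ t → z t = h (x t) (w t)) →
      (∀ t : ℝ, 0 ≤ t → HasDerivAt w (dw t) t) →
      (∀ t : ℝ, 0 ≤ t → HasDerivAt z (dz t) t) →
      ContinuousOn dw (Set.Ici 0) → ContinuousOn dz (Set.Ici 0) →
      ∀ t₀ t₁ : ℝ, 0 ≤ t₀ → t₀ ≤ t₁ →
        Sv (f (x t₁) (w t₁)) - Sv (f (x t₀) (w t₀)) ≤
          ∫ t in t₀..t₁, sv (dw t) (dz t))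
    (hsupply : ∀ ζ : EuclideanSpace ℝ (Fin nz), sv 0 ζ ≤ 0) :
    ∀ (xs : EuclideanSpace ℝ (Fin n)) (ws : EuclideanSpace ℝ (Fin nw)),
      f xs ws = 0 →
      ∀ ε > (0:ℝ), ∃ δ > (0:ℝ),
        ∀ (x : ℝ → EuclideanSpace ℝ (Fin n)) (z : ℝ → EuclideanSpace ℝ (Fin nz))
          (dz : ℝ → EuclideanSpace ℝ (Fin nz)),
          (∀ t : ℝ, 0 ≤ t → HasDerivAt x (f (x t) ws) t) →
          (∀ t : ℝ, 0 ≤ t → z t = h (x t) ws) →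
          (∀ t : ℝ, 0 ≤ t → HasDerivAt z (dz t) t) →
          ContinuousOn dz (Set.Ici 0) →
          ‖x 0 - xs‖ < δ →
          ∀ t : ℝ, 0 ≤ t → ‖x t - xs‖ < ε := by
  intro xs ws hxs ε hε
  have hV : Continuous fun y => Sv (f y ws) :=
    hSv.continuous.comp (hf.continuous.comp (continuous_id.prodMk continuous_const))
  obtain ⟨δ, hδ, hstab⟩ := exists_delta_of_lyapunov hV (xs := xs) (by simp [hxs, hSv0])
    (fun y hy => hSvPos _ fun hy0 => hy (huniq ws y xs hy0 hxs)) hε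
  refine ⟨δ, hδ, fun x z dz hx hz hdz hdzc hx0 => hstab x
    (fun t ht => (hx t ht).continuousAt.continuousWithinAt) (fun t ht => ?_) hx0⟩
  have hdiss := hVD x (fun _ => ws) z (fun _ => 0) dz hx hz
    (fun t _ => hasDerivAt_const t ws) hdz continuousOn_const hdzc 0 t le_rfl ht
  have hint : ∫ s in (0 : ℝ)..t, sv 0 (dz s) ≤ 0 := by
    rw [intervalIntegral.integral_of_le ht]
    exact integral_nonpos fun s => hsupply (dz s)
  exact sub_nonpos.1 (hdiss.trans hint)
end

section
/- Consider the system ẋ(t) = f(x(t)) + B w(t), z(t) = C x(t), with state x(t) in a convex compact set X ⊆ ℝⁿ, f continuously differentiable, B ∈ ℝ^{n×nw}, C ∈ ℝ^{nz×n}, and C B = 0. Let γ ≥ 0 and suppose the system is (γ²I, 0, −I) velocity dissipative: there exists a continuously differentiable storage function S_v : ℝⁿ → [0, ∞) with S_v(0) = 0 and S_v(v) > 0 for v ≠ 0 such that S_v(ẋ(t₁)) − S_v(ẋ(t₀)) ≤ ∫_{t₀}^{t₁} ( γ² ‖ẇ(t)‖² − ‖ż(t)‖² ) dt along all differentiable solutions.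 Let α > 0 satisfy, for every equilibrium state x* and every x ∈ X, (x − x*)ᵀ Ā(x, x*)ᵀ Cᵀ C Ā(x, x*) (x − x*) ≥ α⁻¹ (x − x*)ᵀ Cᵀ C (x − x*), where Ā(x, x*) = ∫₀¹ Df(x* + λ(x − x*)) dλ with Df the Jacobian of f. Fix an equilibrium triple (x*, w*, z*) and β > 0. Then for every differentiable solution (x, w, z) with ẋ(0) = 0 whose input satisfies ẇ(t) = A_w (w(t) − w*) for a matrix A_w with operator norm at most β, and every T > 0: ( ∫₀ᵀ ‖z(t) − z*‖² dt )^{1/2} ≤ √(αβ²γ²) · ( ∫₀ᵀ ‖w(t) − w*‖² dt )^{1/2}, i.e., the universal shifted L₂-gain is bounded by √(αβ²γ²). -/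
open MeasureTheory Set
open scoped RealInnerProductSpace

/-- `Ā(x, x*) = ∫₀¹ Df(x* + λ(x − x*)) dλ`, the averaged Jacobian of `f` along the
segment from `x*` to `x`. -/
noncomputable def avgJac {n : ℕ}
    (f : EuclideanSpace ℝ (Fin n) → EuclideanSpace ℝ (Fin n))
    (x xs : EuclideanSpace ℝ (Fin n)) :
    EuclideanSpace ℝ (Fin n) →L[ℝ] EuclideanSpace ℝ (Fin n) :=
  ∫ lam in (0:ℝ)..1, fderiv ℝ f (xs + lam • (x - xs))

theorem avgJac_apply_sub {n : ℕ}
    {f : EuclideanSpace ℝ (Fin n) → EuclideanSpace ℝ (Fin n)} (hf : ContDiff ℝ 1 f)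
    (x xs : EuclideanSpace ℝ (Fin n)) :
    avgJac f x xs (x - xs) = f x - f xs := by
  have hseg : Continuous fun lam : ℝ => xs + lam • (x - xs) := by fun_prop
  have hcont : Continuous fun lam : ℝ => fderiv ℝ f (xs + lam • (x - xs)) :=
    (hf.continuous_fderiv one_ne_zero).comp hseg
  have hderiv : ∀ lam : ℝ, HasDerivAt (fun lam : ℝ => f (xs + lam • (x - xs)))
      (fderiv ℝ f (xs + lam • (x - xs)) (x - xs)) lam := by
    intro lam
    have hline : HasDerivAt (fun lam : ℝ => xs + lam • (x - xs)) (x - xs) lam := by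
      simpa using ((hasDerivAt_id lam).smul_const (x - xs)).const_add xs
    exact ((hf.differentiable one_ne_zero) _).hasFDerivAt.comp_hasDerivAt lam hline
  rw [avgJac, ContinuousLinearMap.intervalIntegral_apply (hcont.intervalIntegrable 0 1),
    intervalIntegral.integral_eq_sub_of_hasDerivAt (fun lam _ => hderiv lam)
      ((hcont.clm_apply continuous_const).intervalIntegrable 0 1)]
  simp

/-- Along a solution whose output map satisfies `C B = 0`, the output derivative is `C f(x)`. -/
theorem output_deriv_eq {E F W : Type*} [NormedAddCommGroup E] [NormedSpace ℝ E]
    [NormedAddCommGroup F] [NormedSpace ℝ F] [NormedAddCommGroup W] [NormedSpace ℝ W]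
    {f : E → E} {B : W →L[ℝ] E} {C : E →L[ℝ] F} (hCB : C.comp B = 0)
    {x : ℝ → E} {w : ℝ → W} {z dz : ℝ → F}
    (hx : ∀ t : ℝ, 0 ≤ t → HasDerivAt x (f (x t) + B (w t)) t)
    (hz : ∀ t : ℝ, 0 ≤ t → z t = C (x t))
    (hdz : ∀ t : ℝ, 0 ≤ t → HasDerivAt z (dz t) t) {t : ℝ} (ht : 0 ≤ t) :
    dz t = C (f (x t)) := by
  have hCx : HasDerivWithinAt z (C (f (x t) + B (w t))) (Ici 0) t :=
    (C.hasFDerivAt.comp_hasDerivAt t (hx t ht)).hasDerivWithinAt.congr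
      (fun s hs => hz s hs) (hz t ht)
  have hCBw : C (B (w t)) = 0 := DFunLike.congr_fun hCB (w t)
  rw [(uniqueDiffOn_Ici (0 : ℝ) t ht).eq_deriv _ (hdz t ht).hasDerivWithinAt hCx, map_add,
    hCBw, add_zero]

/-- **Bounded universal shifted `L₂`-gain from `(γ²I, 0, −I)` velocity dissipativity.**
For `ẋ = f(x) + Bw`, `z = Cx` on a convex compact state set `X` with `CB = 0`:
if the system is `(γ²I, 0, −I)` velocity dissipative, `α > 0` satisfies the
averaged-Jacobian bound and the input is generated by an exosystem
`ẇ = A_w (w − w*)` with `‖A_w‖ ≤ β`, then the universal shifted `L₂`-gain is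
bounded by `√(αβ²γ²)` on trajectories started at rest. -/
theorem bounded_shifted_L2_gain_from_velocity_dissipativity
    {n nw nz : ℕ}
    (f : EuclideanSpace ℝ (Fin n) → EuclideanSpace ℝ (Fin n))
    (hf : ContDiff ℝ 1 f)
    (B : EuclideanSpace ℝ (Fin nw) →L[ℝ] EuclideanSpace ℝ (Fin n))
    (C : EuclideanSpace ℝ (Fin n) →L[ℝ] EuclideanSpace ℝ (Fin nz))
    (hCB : C.comp B = 0)
    (X : Set (EuclideanSpace ℝ (Fin n))) (hXconv : Convex ℝ X) (hXcomp : IsCompact X)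
    (γ : ℝ) (hγ : 0 ≤ γ)
    (Sv : EuclideanSpace ℝ (Fin n) → ℝ)
    (hSv : ContDiff ℝ 1 Sv) (hSvNonneg : ∀ v, 0 ≤ Sv v) (hSv0 : Sv 0 = 0)
    (hSvPos : ∀ v, v ≠ 0 → 0 < Sv v)
    -- (γ²I, 0, −I) velocity dissipativity along all differentiable solutions
    (hVD : ∀ (x : ℝ → EuclideanSpace ℝ (Fin n)) (w : ℝ → EuclideanSpace ℝ (Fin nw))
        (z : ℝ → EuclideanSpace ℝ (Fin nz))
        (dw : ℝ → EuclideanSpace ℝ (Fin nw)) (dz : ℝ → EuclideanSpace ℝ (Fin nz)),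
      (∀ t : ℝ, 0 ≤ t → x t ∈ X) →
      (∀ t : ℝ, 0 ≤ t → HasDerivAt x (f (x t) + B (w t)) t) →
      (∀ t : ℝ, 0 ≤ t → z t = C (x t)) →
      (∀ t : ℝ, 0 ≤ t → HasDerivAt w (dw t) t) →
      (∀ t : ℝ, 0 ≤ t → HasDerivAt z (dz t) t) →
      ContinuousOn dw (Set.Ici 0) → ContinuousOn dz (Set.Ici 0) →
      ∀ t₀ t₁ : ℝ, 0 ≤ t₀ → t₀ ≤ t₁ →
        Sv (f (x t₁) + B (w t₁)) - Sv (f (x t₀) + B (w t₀)) ≤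
          ∫ t in t₀..t₁, (γ ^ 2 * ‖dw t‖ ^ 2 - ‖dz t‖ ^ 2))
    (α : ℝ) (hα : 0 < α)
    -- averaged Jacobian bound
    (hαbound : ∀ xs : EuclideanSpace ℝ (Fin n), (∃ ws, f xs + B ws = 0) →
      ∀ x ∈ X,
        α⁻¹ * ⟪C (x - xs), C (x - xs)⟫ ≤
          ⟪C ((avgJac f x xs) (x - xs)), C ((avgJac f x xs) (x - xs))⟫)
    -- fixed equilibrium triple and exosystem bound
    (xs : EuclideanSpace ℝ (Fin n)) (ws : EuclideanSpace ℝ (Fin nw))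
    (zs : EuclideanSpace ℝ (Fin nz))
    (heq : f xs + B ws = 0) (hzs : zs = C xs)
    (β : ℝ) (hβ : 0 < β) :
    ∀ (x : ℝ → EuclideanSpace ℝ (Fin n)) (w : ℝ → EuclideanSpace ℝ (Fin nw))
      (z : ℝ → EuclideanSpace ℝ (Fin nz))
      (dw : ℝ → EuclideanSpace ℝ (Fin nw)) (dz : ℝ → EuclideanSpace ℝ (Fin nz)),
      (∀ t : ℝ, 0 ≤ t → x t ∈ X) →
      (∀ t : ℝ, 0 ≤ t → HasDerivAt x (f (x t) + B (w t)) t) →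
      (∀ t : ℝ, 0 ≤ t → z t = C (x t)) →
      (∀ t : ℝ, 0 ≤ t → HasDerivAt w (dw t) t) →
      (∀ t : ℝ, 0 ≤ t → HasDerivAt z (dz t) t) →
      ContinuousOn dw (Set.Ici 0) → ContinuousOn dz (Set.Ici 0) →
      -- started at rest: ẋ(0) = 0
      f (x 0) + B (w 0) = 0 →
      -- input generated by the exosystem ẇ = A_w (w − w*), ‖A_w‖ ≤ β
      (∃ Aw : EuclideanSpace ℝ (Fin nw) →L[ℝ] EuclideanSpace ℝ (Fin nw),
        ‖Aw‖ ≤ β ∧ ∀ t : ℝ, 0 ≤ t → dw t = Aw (w t - ws)) →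
      ∀ T : ℝ, 0 < T →
        Real.sqrt (∫ t in (0:ℝ)..T, ‖z t - zs‖ ^ 2) ≤
          Real.sqrt (α * β ^ 2 * γ ^ 2) *
            Real.sqrt (∫ t in (0:ℝ)..T, ‖w t - ws‖ ^ 2) := by
  intro x w z dw dz hxX hx hz hdw hdz hdwc hdzc hrest hexo T hT
  obtain ⟨Aw, hAw, hexo⟩ := hexo
  have hT0 := hT.le
  have hsub : uIcc 0 T ⊆ Ici (0 : ℝ) := by
    rw [uIcc_of_le hT0]
    exact Icc_subset_Ici_self
  have hwc : ContinuousOn w (Ici 0) := fun t ht => (hdw t ht).continuousAt.continuousWithinAt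
  have hzc : ContinuousOn z (Ici 0) := fun t ht => (hdz t ht).continuousAt.continuousWithinAt
  have hdw_int : IntervalIntegrable (fun t => γ ^ 2 * ‖dw t‖ ^ 2) volume 0 T :=
    (((hdwc.norm.pow 2).const_mul (γ ^ 2)).mono hsub).intervalIntegrable
  have hdz_int : IntervalIntegrable (fun t => ‖dz t‖ ^ 2) volume 0 T :=
    ((hdzc.norm.pow 2).mono hsub).intervalIntegrable
  have hw_int : IntervalIntegrable (fun t => β ^ 2 * γ ^ 2 * ‖w t - ws‖ ^ 2) volume 0 T :=
    (((((hwc.sub continuousOn_const).norm.pow 2)).const_mul (β ^ 2 * γ ^ 2)).mono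
      hsub).intervalIntegrable
  have hz_int : IntervalIntegrable (fun t => α⁻¹ * ‖z t - zs‖ ^ 2) volume 0 T :=
    (((((hzc.sub continuousOn_const).norm.pow 2)).const_mul α⁻¹).mono hsub).intervalIntegrable
  have hCfxs : C (f xs) = 0 := by
    have hCBws : C (B ws) = 0 := DFunLike.congr_fun hCB ws
    simpa [hCBws] using congrArg C heq
  have hz_le : ∀ t ∈ Icc 0 T, α⁻¹ * ‖z t - zs‖ ^ 2 ≤ ‖dz t‖ ^ 2 := by
    intro t ht
    have h := hαbound xs ⟨ws, heq⟩ (x t) (hxX t ht.1)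
    rw [avgJac_apply_sub hf, map_sub C (f (x t)), hCfxs, sub_zero,
      ← output_deriv_eq hCB hx hz hdz ht.1, real_inner_self_eq_norm_sq,
      real_inner_self_eq_norm_sq, map_sub, ← hz t ht.1, ← hzs] at h
    exact h
  have hw_le : ∀ t ∈ Icc 0 T, γ ^ 2 * ‖dw t‖ ^ 2 ≤ β ^ 2 * γ ^ 2 * ‖w t - ws‖ ^ 2 := by
    intro t ht
    have h : ‖dw t‖ ≤ β * ‖w t - ws‖ := hexo t ht.1 ▸ Aw.le_of_opNorm_le hAw _
    calc γ ^ 2 * ‖dw t‖ ^ 2 ≤ γ ^ 2 * (β * ‖w t - ws‖) ^ 2 := by gcongr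
      _ = β ^ 2 * γ ^ 2 * ‖w t - ws‖ ^ 2 := by ring
  have hdiss := hVD x w z dw dz hxX hx hz hdw hdz hdwc hdzc 0 T le_rfl hT0
  rw [hrest, hSv0, sub_zero, intervalIntegral.integral_sub hdw_int hdz_int] at hdiss
  have hz_mono := intervalIntegral.integral_mono_on hT0 hz_int hdz_int hz_le
  have hw_mono := intervalIntegral.integral_mono_on hT0 hdw_int hw_int hw_le
  rw [intervalIntegral.integral_const_mul] at hz_mono
  rw [intervalIntegral.integral_const_mul (β ^ 2 * γ ^ 2)] at hw_mono
  have hbound : α⁻¹ * ∫ t in (0 : ℝ)..T, ‖z t - zs‖ ^ 2 ≤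
      β ^ 2 * γ ^ 2 * ∫ t in (0 : ℝ)..T, ‖w t - ws‖ ^ 2 := by
    linarith [hSvNonneg (f (x T) + B (w T))]
  rw [← Real.sqrt_mul (by positivity)]
  apply Real.sqrt_le_sqrt
  rw [inv_mul_le_iff₀ hα] at hbound
  linarith
end
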